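/- arXiv:1306.2012 — 2 statements merged into one kernel-verified Lean document; each statement's English description precedes it below -/
import Mathlib

section
/- Let r ≥ 3 be fixed. There exist constants C > 0 and δ > 0 depending only on r such that for every degree sequence k with sum M divisible by r, k_max ≥ 2 and k_max^3 ≤ δM, and for every integer ℓ with 1 ≤ ℓ ≤ N and every Q ∈ C_ℓ, the number of 4-tuples (x_1,x_2,y_1,y_2) specifying a legal ℓ-switching in Q equals 2ℓM^2·(1 + E) for some real E with |E| ≤ C·(k_max^2 + ℓ)/M. -/
open scoped Classical BigOperators

/-- The set of points for the configuration model: cell `i` contains `k i` points. -/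
abbrev Pts {n : ℕ} (k : Fin n → ℕ) : Type := (i : Fin n) × Fin (k i)

/-- `M`, the total degree. -/
def Mtot {n : ℕ} (k : Fin n → ℕ) : ℕ := ∑ i, k i

/-- `M₂ = Σ kᵢ(kᵢ−1)`. -/
def M2 {n : ℕ} (k : Fin n → ℕ) : ℕ := ∑ i, k i * (k i - 1)

/-- `M₃ = Σ kᵢ(kᵢ−1)(kᵢ−2)`. -/
def M3 {n : ℕ} (k : Fin n → ℕ) : ℕ := ∑ i, k i * (k i - 1) * (k i - 2)

/-- The maximum degree. -/
def kmax {n : ℕ} (k : Fin n → ℕ) : ℕ := Finset.univ.sup k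

/-- `Q` is an unordered partition of the point set into parts of size `r`. -/
def IsPartition {n : ℕ} (r : ℕ) (k : Fin n → ℕ) (Q : Finset (Finset (Pts k))) : Prop :=
  (∀ U ∈ Q, U.card = r) ∧ ∀ p : Pts k, ∃! U, U ∈ Q ∧ p ∈ U

/-- `Λ_r(k)`, the set of partitions of the points into parts of size `r`. -/
def Lam {n : ℕ} (r : ℕ) (k : Fin n → ℕ) : Set (Finset (Finset (Pts k))) :=
  {Q | IsPartition r k Q}

/-- `Λ_r(k)` as a finset. -/
noncomputable def LamFinset {n : ℕ} (r : ℕ) (k : Fin n → ℕ) :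
    Finset (Finset (Finset (Pts k))) :=
  Finset.univ.filter fun Q => IsPartition r k Q

/-- The set of vertices of the edge of `G(Q)` corresponding to a part `U`. -/
def vset {n : ℕ} {k : Fin n → ℕ} (U : Finset (Pts k)) : Finset (Fin n) :=
  U.image Sigma.fst

/-- Multiplicity of vertex `i` in the edge corresponding to a part `U`. -/
def mult {n : ℕ} {k : Fin n → ℕ} (U : Finset (Pts k)) (i : Fin n) : ℕ :=
  (U.filter fun p => p.1 = i).card

/-- `U` contains a loop: two distinct points lying in the same cell. -/
def HasLoop {n : ℕ} {k : Fin n → ℕ} (U : Finset (Pts k)) : Prop :=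
  ∃ x ∈ U, ∃ y ∈ U, x ≠ y ∧ x.1 = y.1

/-- The number of parts of `Q` which contain a loop. -/
noncomputable def nloops {n : ℕ} {k : Fin n → ℕ} (Q : Finset (Finset (Pts k))) : ℕ :=
  (Q.filter fun U => HasLoop U).card

/-- `N = max(⌈log M⌉, ⌈9(r−1)M₂/M⌉)`. -/
noncomputable def Nbound {n : ℕ} (r : ℕ) (k : Fin n → ℕ) : ℕ :=
  max ⌈Real.log (Mtot k)⌉₊ ⌈(9 * ((r : ℝ) - 1) * (M2 k : ℝ)) / (Mtot k : ℝ)⌉₊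

/-- `Λ_r⁺(k)`: partitions satisfying properties (i)–(iv). -/
noncomputable def LamPlus {n : ℕ} (r : ℕ) (k : Fin n → ℕ) :
    Set (Finset (Finset (Pts k))) :=
  {Q | IsPartition r k Q ∧
    (∀ U ∈ Q, ∀ i, mult U i ≤ 2) ∧
    (∀ U ∈ Q, ∀ i j, mult U i = 2 → mult U j = 2 → i = j) ∧
    (∀ U ∈ Q, ∀ W ∈ Q, U ≠ W → (vset U ∩ vset W).card ≤ 2) ∧
    nloops Q ≤ Nbound r k}

/-- `C_ℓ`: partitions in `Λ_r⁺(k)` with exactly `ℓ` parts containing a loop. -/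
noncomputable def Cset {n : ℕ} (r : ℕ) (k : Fin n → ℕ) (ℓ : ℕ) :
    Set (Finset (Finset (Pts k))) :=
  {Q ∈ LamPlus r k | nloops Q = ℓ}

/-- The result of an ℓ-switching replacing parts `U`, `W₁`, `W₂`. -/
def switchResult {n : ℕ} {k : Fin n → ℕ} (Q : Finset (Finset (Pts k)))
    (U W₁ W₂ : Finset (Pts k)) (x₁ x₂ y₁ y₂ : Pts k) : Finset (Finset (Pts k)) :=
  (Q \ {U, W₁, W₂}) ∪
    {(U \ {x₁, x₂}) ∪ {y₁, y₂}, (W₁ \ {y₁}) ∪ {x₁}, (W₂ \ {y₂}) ∪ {x₂}}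

/-- `(x₁,x₂,y₁,y₂)` specifies an ℓ-switching in `Q` with parts `U`, `W₁`, `W₂`. -/
def IsSwitching {n : ℕ} {k : Fin n → ℕ} (Q : Finset (Finset (Pts k)))
    (U W₁ W₂ : Finset (Pts k)) (x₁ x₂ y₁ y₂ : Pts k) : Prop :=
  U ∈ Q ∧ W₁ ∈ Q ∧ W₂ ∈ Q ∧ U ≠ W₁ ∧ U ≠ W₂ ∧ W₁ ≠ W₂ ∧
  x₁ ∈ U ∧ x₂ ∈ U ∧ x₁ ≠ x₂ ∧ x₁.1 = x₂.1 ∧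
  y₁ ∈ W₁ ∧ y₂ ∈ W₂ ∧ y₁.1 ≠ y₂.1

/-- The result of a reverse ℓ-switching replacing parts `Û`, `Ŵ₁`, `Ŵ₂`. -/
def revSwitchResult {n : ℕ} {k : Fin n → ℕ} (Q' : Finset (Finset (Pts k)))
    (Uh W₁h W₂h : Finset (Pts k)) (x₁ x₂ y₁ y₂ : Pts k) : Finset (Finset (Pts k)) :=
  (Q' \ {Uh, W₁h, W₂h}) ∪
    {(Uh \ {y₁, y₂}) ∪ {x₁, x₂}, (W₁h \ {x₁}) ∪ {y₁}, (W₂h \ {x₂}) ∪ {y₂}}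

/-- `(x₁,x₂,y₁,y₂)` specifies a reverse ℓ-switching in `Q'` with parts `Û`, `Ŵ₁`, `Ŵ₂`. -/
def IsRevSwitching {n : ℕ} {k : Fin n → ℕ} (Q' : Finset (Finset (Pts k)))
    (Uh W₁h W₂h : Finset (Pts k)) (x₁ x₂ y₁ y₂ : Pts k) : Prop :=
  Uh ∈ Q' ∧ W₁h ∈ Q' ∧ W₂h ∈ Q' ∧ Uh ≠ W₁h ∧ Uh ≠ W₂h ∧ W₁h ≠ W₂h ∧
  x₁ ∈ W₁h ∧ x₂ ∈ W₂h ∧ x₁.1 = x₂.1 ∧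
  y₁ ∈ Uh ∧ y₂ ∈ Uh ∧ y₁ ≠ y₂ ∧ y₁.1 ≠ y₂.1

/-- `Q` is simple: every edge of `G(Q)` consists of distinct vertices and all
edges are distinct. -/
def SimpleQ {n : ℕ} {k : Fin n → ℕ} (Q : Finset (Finset (Pts k))) : Prop :=
  (∀ U ∈ Q, (vset U).card = U.card) ∧
  ∀ U ∈ Q, ∀ W ∈ Q, U ≠ W → vset U ≠ vset W

/-- `|H_r(k)|`: the number of simple `r`-uniform hypergraphs on `{1,…,n}` with
degree sequence `k`, a hypergraph being recorded as its (distinct) edge set. -/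
noncomputable def Hcount (r : ℕ) {n : ℕ} (k : Fin n → ℕ) : ℕ :=
  Set.ncard {E : Finset (Finset (Fin n)) |
    (∀ e ∈ E, e.card = r) ∧ ∀ i, (E.filter fun e => i ∈ e).card = k i}

/-- The set of 4-tuples specifying a legal ℓ-switching in `Q`. -/
def legalForwardTuples {n : ℕ} (r : ℕ) (k : Fin n → ℕ) (ℓ : ℕ)
    (Q : Finset (Finset (Pts k))) : Set (Pts k × Pts k × Pts k × Pts k) :=
  {t | ∃ U W₁ W₂, IsSwitching Q U W₁ W₂ t.1 t.2.1 t.2.2.1 t.2.2.2 ∧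
    switchResult Q U W₁ W₂ t.1 t.2.1 t.2.2.1 t.2.2.2 ∈ Cset r k (ℓ - 1)}

lemma mult_le_one {n : ℕ} {k : Fin n → ℕ} {U : Finset (Pts k)} (h : ¬ HasLoop U) (i : Fin n) :
    mult U i ≤ 1 := by
  unfold mult
  rw [Finset.card_le_one]
  intro a ha b hb
  rw [Finset.mem_filter] at ha hb
  by_contra hne
  exact h ⟨a, ha.1, b, hb.1, hne, ha.2.trans hb.2.symm⟩

lemma mem_vset {n : ℕ} {k : Fin n → ℕ} {U : Finset (Pts k)} {p : Pts k} (h : p ∈ U) :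
    p.1 ∈ vset U := Finset.mem_image_of_mem _ h

lemma loop_pair {n : ℕ} {k : Fin n → ℕ} {U : Finset (Pts k)}
    (h1 : ∀ i, mult U i ≤ 2) (h2 : ∀ i j, mult U i = 2 → mult U j = 2 → i = j)
    {x y a b : Pts k} (hx : x ∈ U) (hy : y ∈ U) (hxy : x ≠ y) (he : x.1 = y.1)
    (ha : a ∈ U) (hb : b ∈ U) (hab : a ≠ b) (he' : a.1 = b.1) :
    (a = x ∧ b = y) ∨ (a = y ∧ b = x) := by
  have key : ∀ {x y : Pts k}, x ∈ U → y ∈ U → x ≠ y → x.1 = y.1 →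
      (U.filter fun p => p.1 = x.1) = {x, y} ∧ mult U x.1 = 2 := by
    intro x y hx hy hxy he
    have hs : ({x, y} : Finset (Pts k)) ⊆ U.filter fun p => p.1 = x.1 := by
      intro p hp
      simp only [Finset.mem_insert, Finset.mem_singleton] at hp
      rcases hp with rfl | rfl
      · exact Finset.mem_filter.2 ⟨hx, rfl⟩
      · exact Finset.mem_filter.2 ⟨hy, he.symm⟩
    have hc : ({x, y} : Finset (Pts k)).card = 2 := Finset.card_pair hxy
    have h := h1 x.1
    have heq := Finset.eq_of_subset_of_card_le hs (by rw [hc]; exact h)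
    refine ⟨heq.symm, ?_⟩
    unfold mult
    rw [← heq, hc]
  obtain ⟨f1, m1⟩ := key hx hy hxy he
  obtain ⟨f2, m2⟩ := key ha hb hab he'
  have hax := h2 _ _ m2 m1
  have ha' : a ∈ U.filter fun p => p.1 = x.1 := by simp [ha, hax]
  have hb' : b ∈ U.filter fun p => p.1 = x.1 := by simp [hb, ← he', hax]
  rw [f1] at ha' hb'
  simp only [Finset.mem_insert, Finset.mem_singleton] at ha' hb'
  rcases ha' with h | h <;> rcases hb' with h' | h'
  · exact absurd (h.trans h'.symm) hab
  · exact Or.inl ⟨h, h'⟩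
  · exact Or.inr ⟨h, h'⟩
  · exact absurd (h.trans h'.symm) hab

set_option maxHeartbeats 1000000 in
/-- A sufficient condition for a switching to be legal. -/
lemma legal_of_good {n : ℕ} {r : ℕ} {k : Fin n → ℕ} {ℓ : ℕ} {Q : Finset (Finset (Pts k))}
    (hQ : Q ∈ Cset r k ℓ) {U W₁ W₂ : Finset (Pts k)} {x₁ x₂ y₁ y₂ : Pts k}
    (hU : U ∈ Q) (hW₁ : W₁ ∈ Q) (hW₂ : W₂ ∈ Q) (hx₁ : x₁ ∈ U) (hx₂ : x₂ ∈ U)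
    (hx : x₁ ≠ x₂) (hxc : x₁.1 = x₂.1) (hy₁ : y₁ ∈ W₁) (hy₂ : y₂ ∈ W₂)
    (hd₁ : ∀ Z ∈ Q, ¬ Disjoint (vset Z) (vset U) → Disjoint (vset Z) (vset W₁))
    (hd₂ : ∀ Z ∈ Q, ¬ Disjoint (vset Z) (vset U) → Disjoint (vset Z) (vset W₂))
    (hd : Disjoint (vset W₁) (vset W₂)) (hl₁ : ¬ HasLoop W₁) (hl₂ : ¬ HasLoop W₂) :
    IsSwitching Q U W₁ W₂ x₁ x₂ y₁ y₂ ∧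
      switchResult Q U W₁ W₂ x₁ x₂ y₁ y₂ ∈ Cset r k (ℓ - 1) := by
  obtain ⟨⟨⟨hcard, hpart⟩, hm, hm2, hint, hN⟩, hnl⟩ := hQ
  have hUU : ¬ Disjoint (vset U) (vset U) := by
    rw [Finset.not_disjoint_iff]; exact ⟨x₁.1, mem_vset hx₁, mem_vset hx₁⟩
  have hUW₁ := Finset.disjoint_left.1 (hd₁ U hU hUU)
  have hUW₂ := Finset.disjoint_left.1 (hd₂ U hU hUU)
  have hWW := Finset.disjoint_left.1 hd
  have nUW₁ : U ≠ W₁ := by rintro rfl; exact hUW₁ (mem_vset hx₁) (mem_vset hx₁)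
  have nUW₂ : U ≠ W₂ := by rintro rfl; exact hUW₂ (mem_vset hx₁) (mem_vset hx₁)
  have nWW : W₁ ≠ W₂ := by rintro rfl; exact hWW (mem_vset hy₁) (mem_vset hy₁)
  have nyy : y₁.1 ≠ y₂.1 := fun h => hWW (mem_vset hy₁) (h ▸ mem_vset hy₂)
  refine ⟨⟨hU, hW₁, hW₂, nUW₁, nUW₂, nWW, hx₁, hx₂, hx, hxc, hy₁, hy₂, nyy⟩, ?_⟩
  have uniq : ∀ {A B : Finset (Pts k)} {p : Pts k}, A ∈ Q → B ∈ Q → p ∈ A → p ∈ B → A = B :=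
    fun hA hB hpA hpB => (hpart _).unique ⟨hA, hpA⟩ ⟨hB, hpB⟩
  have y₁U : y₁ ∉ U := fun h => hUW₁ (mem_vset h) (mem_vset hy₁)
  have y₂U : y₂ ∉ U := fun h => hUW₂ (mem_vset h) (mem_vset hy₂)
  have x₁W₁ : x₁ ∉ W₁ := fun h => hUW₁ (mem_vset hx₁) (mem_vset h)
  have x₂W₂ : x₂ ∉ W₂ := fun h => hUW₂ (mem_vset hx₂) (mem_vset h)
  have x₂W₁ : x₂ ∉ W₁ := fun h => hUW₁ (mem_vset hx₂) (mem_vset h)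
  have x₁W₂ : x₁ ∉ W₂ := fun h => hUW₂ (mem_vset hx₁) (mem_vset h)
  have nyy' : y₁ ≠ y₂ := fun h => nyy (h ▸ rfl)
  -- the new parts
  set Uh := (U \ {x₁, x₂}) ∪ {y₁, y₂} with hUh
  set V₁ := (W₁ \ {y₁}) ∪ {x₁} with hV₁
  set V₂ := (W₂ \ {y₂}) ∪ {x₂} with hV₂
  have mUh : ∀ p, p ∈ Uh ↔ (p ∈ U ∧ p ≠ x₁ ∧ p ≠ x₂) ∨ p = y₁ ∨ p = y₂ := by
    intro p; simp [hUh]; tauto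
  have mV₁ : ∀ p, p ∈ V₁ ↔ (p ∈ W₁ ∧ p ≠ y₁) ∨ p = x₁ := by
    intro p; simp [hV₁, or_comm]
  have mV₂ : ∀ p, p ∈ V₂ ↔ (p ∈ W₂ ∧ p ≠ y₂) ∨ p = x₂ := by
    intro p; simp [hV₂, or_comm]
  have mQ : ∀ Z, Z ∈ switchResult Q U W₁ W₂ x₁ x₂ y₁ y₂ ↔
      (Z ∈ Q ∧ Z ≠ U ∧ Z ≠ W₁ ∧ Z ≠ W₂) ∨ Z = Uh ∨ Z = V₁ ∨ Z = V₂ := by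
    intro Z
    simp only [switchResult, Finset.mem_union, Finset.mem_sdiff, Finset.mem_insert,
      Finset.mem_singleton, ← hUh, ← hV₁, ← hV₂]
    tauto
  have other : ∀ p ∈ U, p ≠ x₁ → p ≠ x₂ → p.1 ≠ x₁.1 := by
    intro p hp h1 h2 hc
    rcases loop_pair (hm U hU) (hm2 U hU) hx₁ hx₂ hx hxc hp hx₁ h1 hc with h | h
    · exact h1 h.1
    · exact h2 h.1
  have nlUh : ¬ HasLoop Uh := by
    rintro ⟨a, ha, b, hb, hab, hc⟩
    rw [mUh] at ha hb
    rcases ha with ⟨ha, ha1, ha2⟩ | rfl | rfl <;> rcases hb with ⟨hb, hb1, hb2⟩ | rfl | rfl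
    · rcases loop_pair (hm U hU) (hm2 U hU) hx₁ hx₂ hx hxc ha hb hab hc with h | h
      · exact ha1 h.1
      · exact ha2 h.1
    · exact hUW₁ (mem_vset ha) (hc ▸ mem_vset hy₁)
    · exact hUW₂ (mem_vset ha) (hc ▸ mem_vset hy₂)
    · exact hUW₁ (mem_vset hb) (hc ▸ mem_vset hy₁)
    · exact hab rfl
    · exact nyy hc
    · exact hUW₂ (mem_vset hb) (hc ▸ mem_vset hy₂)
    · exact nyy hc.symm
    · exact hab rfl
  have nlV₁ : ¬ HasLoop V₁ := by
    rintro ⟨a, ha, b, hb, hab, hc⟩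
    rw [mV₁] at ha hb
    rcases ha with ⟨ha, -⟩ | rfl <;> rcases hb with ⟨hb, -⟩ | rfl
    · exact hl₁ ⟨a, ha, b, hb, hab, hc⟩
    · exact hUW₁ (mem_vset hx₁) (hc ▸ mem_vset ha)
    · exact hUW₁ (mem_vset hx₁) (hc ▸ mem_vset hb)
    · exact hab rfl
  have nlV₂ : ¬ HasLoop V₂ := by
    rintro ⟨a, ha, b, hb, hab, hc⟩
    rw [mV₂] at ha hb
    rcases ha with ⟨ha, -⟩ | rfl <;> rcases hb with ⟨hb, -⟩ | rfl
    · exact hl₂ ⟨a, ha, b, hb, hab, hc⟩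
    · exact hUW₂ (mem_vset hx₂) (hc ▸ mem_vset ha)
    · exact hUW₂ (mem_vset hx₂) (hc ▸ mem_vset hb)
    · exact hab rfl
  have vUh : ∀ i ∈ vset Uh, (i ∈ vset U ∧ i ≠ x₁.1) ∨ i = y₁.1 ∨ i = y₂.1 := by
    intro i hi
    obtain ⟨p, hp, rfl⟩ := Finset.mem_image.1 hi
    rcases (mUh p).1 hp with ⟨h, h1, h2⟩ | rfl | rfl
    · exact Or.inl ⟨mem_vset h, other p h h1 h2⟩
    · exact Or.inr (Or.inl rfl)
    · exact Or.inr (Or.inr rfl)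
  have vV₁ : ∀ i ∈ vset V₁, i ∈ vset W₁ ∨ i = x₁.1 := by
    intro i hi
    obtain ⟨p, hp, rfl⟩ := Finset.mem_image.1 hi
    rcases (mV₁ p).1 hp with ⟨h, h1⟩ | rfl
    · exact Or.inl (mem_vset h)
    · exact Or.inr rfl
  have vV₂ : ∀ i ∈ vset V₂, i ∈ vset W₂ ∨ i = x₁.1 := by
    intro i hi
    obtain ⟨p, hp, rfl⟩ := Finset.mem_image.1 hi
    rcases (mV₂ p).1 hp with ⟨h, h1⟩ | rfl
    · exact Or.inl (mem_vset h)
    · exact Or.inr hxc.symm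
  have nloopsEq : nloops (switchResult Q U W₁ W₂ x₁ x₂ y₁ y₂) = ℓ - 1 := by
    have : (switchResult Q U W₁ W₂ x₁ x₂ y₁ y₂).filter (fun U => HasLoop U) =
        (Q.filter fun U => HasLoop U).erase U := by
      ext Z
      simp only [Finset.mem_filter, Finset.mem_erase, mQ]
      constructor
      · rintro ⟨⟨h, h1, -, -⟩ | rfl | rfl | rfl, hl⟩
        · exact ⟨h1, h, hl⟩
        all_goals contradiction
      · rintro ⟨h1, h, hl⟩
        refine ⟨Or.inl ⟨h, h1, ?_, ?_⟩, hl⟩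
        · rintro rfl; contradiction
        · rintro rfl; contradiction
    unfold nloops at hnl ⊢
    rw [this, Finset.card_erase_of_mem, hnl]
    exact Finset.mem_filter.2 ⟨hU, x₁, hx₁, x₂, hx₂, hx, hxc⟩
  have pair_le : ∀ (S : Finset (Fin n)) (a b : Fin n), (∀ i ∈ S, i = a ∨ i = b) → S.card ≤ 2 := by
    intro S a b h
    refine (Finset.card_le_card (t := {a, b}) ?_).trans Finset.card_le_two
    intro i hi; simpa using h i hi
  -- intersection of the new parts with the old ones
  have iUh : ∀ Z ∈ Q, Z ≠ U → (vset Uh ∩ vset Z).card ≤ 2 := by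
    intro Z hZ hne
    by_cases hdz : Disjoint (vset Z) (vset U)
    · apply pair_le _ y₁.1 y₂.1
      intro i hi
      rw [Finset.mem_inter] at hi
      rcases vUh i hi.1 with h | h
      · exact absurd h.1 (Finset.disjoint_left.1 hdz hi.2)
      · exact h
    · refine (Finset.card_le_card ?_).trans (hint U hU Z hZ hne.symm)
      intro i hi
      rw [Finset.mem_inter] at hi ⊢
      rcases vUh i hi.1 with h | rfl | rfl
      · exact ⟨h.1, hi.2⟩
      · exact absurd (mem_vset hy₁) (Finset.disjoint_left.1 (hd₁ Z hZ hdz) hi.2)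
      · exact absurd (mem_vset hy₂) (Finset.disjoint_left.1 (hd₂ Z hZ hdz) hi.2)
  have iV : ∀ W ∈ Q, ∀ V : Finset (Pts k), (∀ i ∈ vset V, i ∈ vset W ∨ i = x₁.1) →
      (∀ Z ∈ Q, ¬ Disjoint (vset Z) (vset U) → Disjoint (vset Z) (vset W)) →
      ∀ Z ∈ Q, Z ≠ W → (vset V ∩ vset Z).card ≤ 2 := by
    intro W hW V hV hdW Z hZ hne
    by_cases hv : x₁.1 ∈ vset Z
    · have hdz := hdW Z hZ (Finset.not_disjoint_iff.2 ⟨_, hv, mem_vset hx₁⟩)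
      apply pair_le _ x₁.1 x₁.1
      intro i hi
      rw [Finset.mem_inter] at hi
      rcases hV i hi.1 with h | h
      · exact absurd h (Finset.disjoint_left.1 hdz hi.2)
      · exact Or.inl h
    · refine (Finset.card_le_card ?_).trans (hint W hW Z hZ hne.symm)
      intro i hi
      rw [Finset.mem_inter] at hi ⊢
      rcases hV i hi.1 with h | rfl
      · exact ⟨h, hi.2⟩
      · exact absurd hi.2 hv
  have iV₁ := iV W₁ hW₁ V₁ vV₁ hd₁
  have iV₂ := iV W₂ hW₂ V₂ vV₂ hd₂
  have iVV : (vset V₁ ∩ vset V₂).card ≤ 2 := by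
    apply pair_le _ x₁.1 x₁.1
    intro i hi
    rw [Finset.mem_inter] at hi
    rcases vV₁ i hi.1 with h | h
    · rcases vV₂ i hi.2 with h' | h'
      · exact absurd h' (hWW h)
      · exact Or.inl h'
    · exact Or.inl h
  have iUV : ∀ W V : Finset (Pts k), (∀ i ∈ vset V, i ∈ vset W ∨ i = x₁.1) →
      (∀ i ∈ vset U, i ∉ vset W) → (vset Uh ∩ vset V).card ≤ 2 := by
    intro W V hV hUW
    apply pair_le _ y₁.1 y₂.1
    intro i hi
    rw [Finset.mem_inter] at hi
    rcases vUh i hi.1 with ⟨h, h1⟩ | h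
    · rcases hV i hi.2 with h' | h'
      · exact absurd h' (hUW i h)
      · exact absurd h' h1
    · exact h
  have iUV₁ := iUV W₁ V₁ vV₁ (fun _ h => hUW₁ h)
  have iUV₂ := iUV W₂ V₂ vV₂ (fun _ h => hUW₂ h)
  have cardV : ∀ (W : Finset (Pts k)) (x y : Pts k), y ∈ W → x ∉ W →
      ((W \ {y}) ∪ {x}).card = W.card := by
    intro W x y hy hx
    rw [Finset.card_union_of_disjoint, Finset.card_sdiff_of_subset (by simpa using hy)]
    · have : 0 < W.card := Finset.card_pos.2 ⟨y, hy⟩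
      simp; omega
    · simp [hx]
  refine ⟨⟨⟨?_, ?_⟩, ?_, ?_, ?_, ?_⟩, nloopsEq⟩
  · intro Z hZ
    rcases (mQ Z).1 hZ with h | rfl | rfl | rfl
    · exact hcard Z h.1
    · rw [hUh, Finset.card_union_of_disjoint, Finset.card_sdiff_of_subset, Finset.card_pair hx,
        Finset.card_pair nyy', hcard U hU]
      · have : ({x₁, x₂} : Finset (Pts k)).card ≤ U.card := Finset.card_le_card (by
          intro p hp
          simp only [Finset.mem_insert, Finset.mem_singleton] at hp
          rcases hp with rfl | rfl <;> assumption)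
        rw [Finset.card_pair hx, hcard U hU] at this
        omega
      · intro p hp
        simp only [Finset.mem_insert, Finset.mem_singleton] at hp
        rcases hp with rfl | rfl <;> assumption
      · rw [Finset.disjoint_left]
        intro p hp hp'
        simp only [Finset.mem_insert, Finset.mem_singleton] at hp'
        have := (Finset.mem_sdiff.1 hp).1
        rcases hp' with rfl | rfl <;> contradiction
    · rw [hV₁, cardV _ _ _ hy₁ x₁W₁, hcard _ hW₁]
    · rw [hV₂, cardV _ _ _ hy₂ x₂W₂, hcard _ hW₂]
  · intro p
    have ex : ∃ Z, Z ∈ switchResult Q U W₁ W₂ x₁ x₂ y₁ y₂ ∧ p ∈ Z := by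
      obtain ⟨Z, ⟨hZ, hpZ⟩, -⟩ := hpart p
      by_cases h1 : Z = U
      · subst h1
        by_cases a : p = x₁
        · exact ⟨V₁, (mQ _).2 (by simp), (mV₁ p).2 (Or.inr a)⟩
        by_cases b : p = x₂
        · exact ⟨V₂, (mQ _).2 (by simp), (mV₂ p).2 (Or.inr b)⟩
        exact ⟨Uh, (mQ _).2 (by simp), (mUh p).2 (Or.inl ⟨hpZ, a, b⟩)⟩
      by_cases h2 : Z = W₁
      · subst h2
        by_cases a : p = y₁
        · exact ⟨Uh, (mQ _).2 (by simp), (mUh p).2 (Or.inr (Or.inl a))⟩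
        exact ⟨V₁, (mQ _).2 (by simp), (mV₁ p).2 (Or.inl ⟨hpZ, a⟩)⟩
      by_cases h3 : Z = W₂
      · subst h3
        by_cases a : p = y₂
        · exact ⟨Uh, (mQ _).2 (by simp), (mUh p).2 (Or.inr (Or.inr a))⟩
        exact ⟨V₂, (mQ _).2 (by simp), (mV₂ p).2 (Or.inl ⟨hpZ, a⟩)⟩
      exact ⟨Z, (mQ _).2 (Or.inl ⟨hZ, h1, h2, h3⟩), hpZ⟩
    have dWW : p ∈ W₁ → p ∉ W₂ := fun h h' => nWW (uniq hW₁ hW₂ h h')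
    have dUW₁ : p ∈ U → p ∉ W₁ := fun h h' => nUW₁ (uniq hU hW₁ h h')
    have dUW₂ : p ∈ U → p ∉ W₂ := fun h h' => nUW₂ (uniq hU hW₂ h h')
    have old : ∀ Z, Z ∈ Q → Z ≠ U → Z ≠ W₁ → Z ≠ W₂ → p ∈ Z → ¬ (p ∈ U ∨ p ∈ W₁ ∨ p ∈ W₂) := by
      rintro Z hZ a b c hp (h | h | h)
      · exact a (uniq hZ hU hp h)
      · exact b (uniq hZ hW₁ hp h)
      · exact c (uniq hZ hW₂ hp h)
    have u1 : p ∈ Uh → p ∉ V₁ := by rw [mUh, mV₁]; clear * - y₁U y₂U x₁W₁ x₂W₂ x₂W₁ x₁W₂ nyy' dWW dUW₁ dUW₂ hx hy₁ hy₂ hx₁ hx₂; grind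
    have u2 : p ∈ Uh → p ∉ V₂ := by rw [mUh, mV₂]; clear * - y₁U y₂U x₁W₁ x₂W₂ x₂W₁ x₁W₂ nyy' dWW dUW₁ dUW₂ hx hy₁ hy₂ hx₁ hx₂; grind
    have u3 : p ∈ V₁ → p ∉ V₂ := by rw [mV₁, mV₂]; clear * - y₁U y₂U x₁W₁ x₂W₂ x₂W₁ x₁W₂ nyy' dWW dUW₁ dUW₂ hx hy₁ hy₂ hx₁ hx₂; grind
    have o1 : p ∈ Uh → p ∈ U ∨ p ∈ W₁ ∨ p ∈ W₂ := by rw [mUh]; clear * - y₁U y₂U x₁W₁ x₂W₂ x₂W₁ x₁W₂ nyy' dWW dUW₁ dUW₂ hx hy₁ hy₂ hx₁ hx₂; grind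
    have o2 : p ∈ V₁ → p ∈ U ∨ p ∈ W₁ ∨ p ∈ W₂ := by rw [mV₁]; clear * - y₁U y₂U x₁W₁ x₂W₂ x₂W₁ x₁W₂ nyy' dWW dUW₁ dUW₂ hx hy₁ hy₂ hx₁ hx₂; grind
    have o3 : p ∈ V₂ → p ∈ U ∨ p ∈ W₁ ∨ p ∈ W₂ := by rw [mV₂]; clear * - y₁U y₂U x₁W₁ x₂W₂ x₂W₁ x₁W₂ nyy' dWW dUW₁ dUW₂ hx hy₁ hy₂ hx₁ hx₂; grind
    obtain ⟨Z, hZ, hpZ⟩ := ex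
    refine ⟨Z, ⟨hZ, hpZ⟩, ?_⟩
    rintro Z' ⟨hZ', hpZ'⟩
    rw [mQ] at hZ hZ'
    clear_value Uh V₁ V₂
    clear mQ mUh mV₁ mV₂
    rcases hZ with ⟨a, b, c, d⟩ | rfl | rfl | rfl <;>
      rcases hZ' with ⟨a', b', c', d'⟩ | rfl | rfl | rfl
    · exact uniq a' a hpZ' hpZ
    · exact absurd (o1 hpZ') (old _ a b c d hpZ)
    · exact absurd (o2 hpZ') (old _ a b c d hpZ)
    · exact absurd (o3 hpZ') (old _ a b c d hpZ)
    · exact absurd (o1 hpZ) (old _ a' b' c' d' hpZ')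
    · rfl
    · exact absurd hpZ' (u1 hpZ)
    · exact absurd hpZ' (u2 hpZ)
    · exact absurd (o2 hpZ) (old _ a' b' c' d' hpZ')
    · exact absurd hpZ (u1 hpZ')
    · rfl
    · exact absurd hpZ' (u3 hpZ)
    · exact absurd (o3 hpZ) (old _ a' b' c' d' hpZ')
    · exact absurd hpZ (u2 hpZ')
    · exact absurd hpZ (u3 hpZ')
    · rfl
  · intro Z hZ i
    rcases (mQ Z).1 hZ with h | h | h | h
    · exact hm Z h.1 i
    · exact (mult_le_one (h ▸ nlUh) i).trans (by norm_num)
    · exact (mult_le_one (h ▸ nlV₁) i).trans (by norm_num)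
    · exact (mult_le_one (h ▸ nlV₂) i).trans (by norm_num)
  · intro Z hZ i j hi hj
    rcases (mQ Z).1 hZ with h | h | h | h
    · exact hm2 Z h.1 i j hi hj
    · have := mult_le_one (U := Z) (h ▸ nlUh) i; omega
    · have := mult_le_one (U := Z) (h ▸ nlV₁) i; omega
    · have := mult_le_one (U := Z) (h ▸ nlV₂) i; omega
  · intro A hA B hB hne
    rw [mQ] at hA hB
    clear_value Uh V₁ V₂
    rcases hA with ⟨a, b, c, d⟩ | rfl | rfl | rfl <;>
      rcases hB with ⟨a', b', c', d'⟩ | rfl | rfl | rfl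
    all_goals first
      | exact absurd rfl hne
      | exact hint _ a _ a' hne
      | exact iUh _ a' b'
      | exact iV₁ _ a' c'
      | exact iV₂ _ a' d'
      | assumption
      | rw [Finset.inter_comm]
        first
          | exact iUh _ a b
          | exact iV₁ _ a c
          | exact iV₂ _ a d
          | assumption
  · rw [nloopsEq]; omega

lemma card_cells {n : ℕ} {k : Fin n → ℕ} (S : Finset (Fin n)) :
    ((Finset.univ : Finset (Pts k)).filter fun p => p.1 ∈ S).card ≤ S.card * kmax k := by
  have : ((Finset.univ : Finset (Pts k)).filter fun p => p.1 ∈ S) =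
      S.sigma fun i => (Finset.univ : Finset (Fin (k i))) := by
    ext p; simp
  rw [this, Finset.card_sigma]
  refine Finset.sum_le_card_nsmul _ _ _ fun i _ => ?_
  rw [Finset.card_univ, Fintype.card_fin]
  exact Finset.le_sup (Finset.mem_univ i)

lemma card_Pts {n : ℕ} (k : Fin n → ℕ) : Fintype.card (Pts k) = Mtot k := by
  simp [Mtot]

section
variable {n : ℕ} {r : ℕ} {k : Fin n → ℕ} {Q : Finset (Finset (Pts k))}
  {P : Pts k → Finset (Pts k)}

lemma card_meet (hc : ∀ U ∈ Q, U.card = r) (hP : ∀ p, P p ∈ Q ∧ p ∈ P p)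
    (hu : ∀ U ∈ Q, ∀ p ∈ U, U = P p) (S : Finset (Fin n)) :
    (Finset.univ.filter fun p => ¬ Disjoint S (vset (P p))).card ≤ S.card * kmax k * r := by
  have hsub : (Finset.univ.filter fun p => ¬ Disjoint S (vset (P p))) ⊆
      ((Finset.univ : Finset (Pts k)).filter fun p => p.1 ∈ S).biUnion P := by
    intro p hp
    obtain ⟨i, hi, hi'⟩ := Finset.not_disjoint_iff.1 (Finset.mem_filter.1 hp).2
    obtain ⟨q, hq, rfl⟩ := Finset.mem_image.1 hi'
    rw [Finset.mem_biUnion]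
    refine ⟨q, by simpa using hi, ?_⟩
    rw [← hu _ (hP p).1 q hq]
    exact (hP p).2
  refine (Finset.card_le_card hsub).trans ((Finset.card_biUnion_le_card_mul _ _ r ?_).trans ?_)
  · intro p _; exact (hc _ (hP p).1).le
  · exact Nat.mul_le_mul_right _ (card_cells S)

/-- The cells within distance two of a part. -/
noncomputable def Dcells (Q : Finset (Finset (Pts k))) (U : Finset (Pts k)) : Finset (Fin n) :=
  (Q.filter fun Z => ¬ Disjoint (vset Z) (vset U)).biUnion vset

lemma card_vset_le (hc : ∀ U ∈ Q, U.card = r) {U : Finset (Pts k)} (hU : U ∈ Q) :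
    (vset U).card ≤ r := (hc U hU) ▸ Finset.card_image_le

lemma card_Dcells (hc : ∀ U ∈ Q, U.card = r)
    (hu : ∀ U ∈ Q, ∀ p ∈ U, U = P p) {U : Finset (Pts k)} (hU : U ∈ Q) :
    (Dcells Q U).card ≤ r * kmax k * r := by
  have hsub : (Q.filter fun Z => ¬ Disjoint (vset Z) (vset U)) ⊆
      ((Finset.univ : Finset (Pts k)).filter fun p => p.1 ∈ vset U).image P := by
    intro Z hZ
    rw [Finset.mem_filter] at hZ
    obtain ⟨i, hi, hi'⟩ := Finset.not_disjoint_iff.1 hZ.2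
    obtain ⟨q, hq, rfl⟩ := Finset.mem_image.1 hi
    rw [Finset.mem_image]
    exact ⟨q, by simpa using hi', (hu Z hZ.1 q hq).symm⟩
  refine (Finset.card_biUnion_le_card_mul _ _ r ?_).trans ?_
  · intro Z hZ; exact card_vset_le hc (Finset.mem_filter.1 hZ).1
  · refine Nat.mul_le_mul_right _ ((Finset.card_le_card hsub).trans
      (Finset.card_image_le.trans ((card_cells _).trans ?_)))
    exact Nat.mul_le_mul_right _ (card_vset_le hc hU)

/-- Points excluded as `y₁` or `y₂`. -/
noncomputable def badPts (Q : Finset (Finset (Pts k))) (P : Pts k → Finset (Pts k))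
    (U : Finset (Pts k)) : Finset (Pts k) :=
  (Finset.univ.filter fun p => ¬ Disjoint (Dcells Q U) (vset (P p))) ∪
    (Q.filter fun U => HasLoop U).biUnion id

lemma card_badPts (hc : ∀ U ∈ Q, U.card = r) (hP : ∀ p, P p ∈ Q ∧ p ∈ P p)
    (hu : ∀ U ∈ Q, ∀ p ∈ U, U = P p) {U : Finset (Pts k)} (hU : U ∈ Q) :
    (badPts Q P U).card ≤ r ^ 3 * kmax k ^ 2 + nloops Q * r := by
  refine (Finset.card_union_le _ _).trans (Nat.add_le_add ?_ ?_)
  · refine (card_meet hc hP hu _).trans ?_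
    calc _ ≤ (r * kmax k * r) * kmax k * r := by gcongr; exact card_Dcells hc hu hU
      _ = _ := by ring
  · refine Finset.card_biUnion_le_card_mul _ _ r ?_
    intro Z hZ; exact (hc Z (Finset.mem_filter.1 hZ).1).le

/-- Pairs `(y₁, y₂)` which are certainly fine. -/
noncomputable def goodPairs (Q : Finset (Finset (Pts k))) (P : Pts k → Finset (Pts k))
    (U : Finset (Pts k)) : Finset (Pts k × Pts k) :=
  Finset.univ.filter fun t => t.1 ∉ badPts Q P U ∧ t.2 ∉ badPts Q P U ∧
    Disjoint (vset (P t.1)) (vset (P t.2))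

lemma card_goodPairs (hc : ∀ U ∈ Q, U.card = r) (hP : ∀ p, P p ∈ Q ∧ p ∈ P p)
    (hu : ∀ U ∈ Q, ∀ p ∈ U, U = P p) {U : Finset (Pts k)} (hU : U ∈ Q) :
    Mtot k ^ 2 ≤ (goodPairs Q P U).card +
      Mtot k * (2 * (r ^ 3 * kmax k ^ 2 + nloops Q * r) + r * kmax k * r) := by
  set b := badPts Q P U with hb
  have hcov : (Finset.univ : Finset (Pts k × Pts k)) ⊆ goodPairs Q P U ∪
      ((b ×ˢ Finset.univ) ∪ ((Finset.univ ×ˢ b) ∪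
        (Finset.univ.sigma fun p : Pts k => Finset.univ.filter fun q =>
          ¬ Disjoint (vset (P p)) (vset (P q))).image fun t => (t.1, t.2))) := by
    rintro ⟨p, q⟩ -
    simp only [goodPairs, Finset.mem_union, Finset.mem_filter, Finset.mem_univ, true_and,
      Finset.mem_product, and_true, Finset.mem_image, Finset.mem_sigma, Prod.mk.injEq, ← hb]
    by_cases h1 : p ∈ b
    · tauto
    by_cases h2 : q ∈ b
    · tauto
    by_cases h3 : Disjoint (vset (P p)) (vset (P q))
    · tauto
    · exact Or.inr (Or.inr (Or.inr ⟨⟨p, q⟩, h3, rfl, rfl⟩))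
  have h := Finset.card_le_card hcov
  rw [Finset.card_univ, Fintype.card_prod, card_Pts] at h
  have hb' := card_badPts hc hP hu hU
  have e1 : (b ×ˢ (Finset.univ : Finset (Pts k))).card = b.card * Mtot k := by
    rw [Finset.card_product, Finset.card_univ, card_Pts]
  have e2 : ((Finset.univ : Finset (Pts k)) ×ˢ b).card = Mtot k * b.card := by
    rw [Finset.card_product, Finset.card_univ, card_Pts]
  have e3 : ((Finset.univ.sigma fun p : Pts k => Finset.univ.filter fun q =>
          ¬ Disjoint (vset (P p)) (vset (P q))).image fun t => (t.1, t.2)).card ≤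
          Mtot k * (r * kmax k * r) := by
    refine Finset.card_image_le.trans ?_
    rw [Finset.card_sigma, ← card_Pts, ← Finset.card_univ]
    refine Finset.sum_le_card_nsmul _ _ _ fun p _ => ?_
    refine (card_meet hc hP hu _).trans ?_
    gcongr
    exact card_vset_le hc (hP p).1
  have h1 := Finset.card_union_le (goodPairs Q P U)
    ((b ×ˢ Finset.univ) ∪ ((Finset.univ ×ˢ b) ∪
        (Finset.univ.sigma fun p : Pts k => Finset.univ.filter fun q =>
          ¬ Disjoint (vset (P p)) (vset (P q))).image fun t => (t.1, t.2)))
  have h2 := Finset.card_union_le (b ×ˢ Finset.univ) ((Finset.univ ×ˢ b) ∪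
        (Finset.univ.sigma fun p : Pts k => Finset.univ.filter fun q =>
          ¬ Disjoint (vset (P p)) (vset (P q))).image fun t => (t.1, t.2))
  have h3 := Finset.card_union_le ((Finset.univ : Finset (Pts k)) ×ˢ b)
        ((Finset.univ.sigma fun p : Pts k => Finset.univ.filter fun q =>
          ¬ Disjoint (vset (P p)) (vset (P q))).image fun t => (t.1, t.2))
  have h4 := Nat.mul_le_mul_left (Mtot k) hb'
  rw [e1] at h2
  rw [e2] at h3
  nlinarith

/-- Ordered loops. -/
noncomputable def loopPairs (P : Pts k → Finset (Pts k)) : Finset (Pts k × Pts k) :=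
  Finset.univ.filter fun t => t.1 ≠ t.2 ∧ t.1.1 = t.2.1 ∧ P t.1 = P t.2

lemma card_loopPairs (hP : ∀ p, P p ∈ Q ∧ p ∈ P p)
    (hu : ∀ U ∈ Q, ∀ p ∈ U, U = P p) (h1 : ∀ U ∈ Q, ∀ i, mult U i ≤ 2)
    (h2 : ∀ U ∈ Q, ∀ i j, mult U i = 2 → mult U j = 2 → i = j) :
    (loopPairs P).card = 2 * nloops Q := by
  have hmaps : ∀ t ∈ loopPairs P, P t.1 ∈ Q.filter fun U => HasLoop U := by
    rintro ⟨a, b⟩ ht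
    obtain ⟨-, hab, hc, he⟩ := Finset.mem_filter.1 ht
    exact Finset.mem_filter.2 ⟨(hP a).1, a, (hP a).2, b, he ▸ (hP b).2, hab, hc⟩
  rw [Finset.card_eq_sum_card_fiberwise hmaps]
  rw [Finset.sum_const_nat (m := 2)]
  · rw [mul_comm]; rfl
  · intro U hU
    obtain ⟨hU, x, hx, y, hy, hxy, he⟩ := Finset.mem_filter.1 hU
    have : (loopPairs P).filter (fun t => P t.1 = U) = {(x, y), (y, x)} := by
      ext ⟨a, b⟩
      simp only [loopPairs, Finset.mem_filter, Finset.mem_univ, true_and, Finset.mem_insert,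
        Finset.mem_singleton, Prod.mk.injEq]
      constructor
      · rintro ⟨⟨hab, hc, hpp⟩, rfl⟩
        exact loop_pair (h1 _ hU) (h2 _ hU) hx hy hxy he (hP a).2 (hpp ▸ (hP b).2) hab hc
      · have ex := hu U hU x hx
        have ey := hu U hU y hy
        rintro (⟨rfl, rfl⟩ | ⟨rfl, rfl⟩)
        · exact ⟨⟨hxy, he, ex.symm.trans ey⟩, ex.symm⟩
        · exact ⟨⟨hxy.symm, he.symm, ey.symm.trans ex⟩, ey.symm⟩
    rw [this, Finset.card_pair]
    simp [hxy]

end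

lemma ncard_bounds {n : ℕ} {r : ℕ} {k : Fin n → ℕ} {ℓ : ℕ} {Q : Finset (Finset (Pts k))}
    (hQ : Q ∈ Cset r k ℓ) :
    Set.ncard (legalForwardTuples r k ℓ Q) ≤ 2 * ℓ * Mtot k ^ 2 ∧
    2 * ℓ * Mtot k ^ 2 ≤ Set.ncard (legalForwardTuples r k ℓ Q) +
      2 * ℓ * (Mtot k * (2 * (r ^ 3 * kmax k ^ 2 + ℓ * r) + r * kmax k * r)) := by
  have hQ' := hQ
  obtain ⟨⟨⟨hc, hpart⟩, hm, hm2, hint, hN⟩, hnl⟩ := hQ'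
  choose P hP hu using hpart
  replace hu : ∀ U ∈ Q, ∀ p ∈ U, U = P p := fun U hU p hp => hu p U ⟨hU, hp⟩
  replace hP : ∀ p, P p ∈ Q ∧ p ∈ P p := hP
  have hL := card_loopPairs hP hu hm hm2
  rw [hnl] at hL
  let e : (Pts k × Pts k) × (Pts k × Pts k) → Pts k × Pts k × Pts k × Pts k :=
    fun t => (t.1.1, t.1.2, t.2.1, t.2.2)
  have hinj : Function.Injective e := by
    rintro ⟨⟨a, b⟩, ⟨c, d⟩⟩ ⟨⟨a', b'⟩, ⟨c', d'⟩⟩ h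
    simp only [e, Prod.mk.injEq] at h ⊢
    tauto
  constructor
  · have hsub : legalForwardTuples r k ℓ Q ⊆
        ((loopPairs P ×ˢ (Finset.univ : Finset (Pts k × Pts k))).image e :
          Finset (Pts k × Pts k × Pts k × Pts k)) := by
      rintro ⟨x₁, x₂, y₁, y₂⟩ ⟨U, W₁, W₂, ⟨hU, -, -, -, -, -, hx₁, hx₂, hx, hxc, -⟩, -⟩
      rw [Finset.mem_coe, Finset.mem_image]
      refine ⟨((x₁, x₂), (y₁, y₂)), ?_, rfl⟩
      simp only [Finset.mem_product, Finset.mem_univ, and_true, loopPairs, Finset.mem_filter,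
        true_and]
      exact ⟨hx, hxc, (hu U hU _ hx₁).symm.trans (hu U hU _ hx₂)⟩
    have h := Set.ncard_le_ncard hsub (Finset.finite_toSet _)
    rw [Set.ncard_coe_finset, Finset.card_image_of_injective _ hinj, Finset.card_product, hL,
      Finset.card_univ, Fintype.card_prod, card_Pts] at h
    rw [pow_two]; exact h
  · let G : Finset (Pts k × Pts k × Pts k × Pts k) :=
      ((loopPairs P).sigma fun t => goodPairs Q P (P t.1)).image fun t => e (t.1, t.2)
    have hsub : (G : Set _) ⊆ legalForwardTuples r k ℓ Q := by
      intro t ht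
      rw [Finset.mem_coe, Finset.mem_image] at ht
      obtain ⟨⟨⟨x₁, x₂⟩, ⟨y₁, y₂⟩⟩, ht, rfl⟩ := ht
      obtain ⟨hx, hy⟩ := Finset.mem_sigma.1 ht
      obtain ⟨-, hx, hxc, he⟩ := Finset.mem_filter.1 hx
      obtain ⟨-, hb₁, hb₂, hd⟩ := Finset.mem_filter.1 hy
      dsimp only at hx hxc he hb₁ hb₂ hd
      have hD : ∀ y, y ∉ badPts Q P (P x₁) →
          (∀ Z ∈ Q, ¬ Disjoint (vset Z) (vset (P x₁)) → Disjoint (vset Z) (vset (P y))) ∧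
          ¬ HasLoop (P y) := by
        intro y hy
        unfold badPts at hy
        rw [Finset.mem_union, not_or] at hy
        constructor
        · intro Z hZ hdz
          have hdis : Disjoint (Dcells Q (P x₁)) (vset (P y)) := by
            by_contra hcon
            exact hy.1 (Finset.mem_filter.2 ⟨Finset.mem_univ _, hcon⟩)
          refine Finset.disjoint_of_subset_left ?_ hdis
          intro i hi
          exact Finset.mem_biUnion.2 ⟨Z, Finset.mem_filter.2 ⟨hZ, hdz⟩, hi⟩
        · intro hl
          exact hy.2 (Finset.mem_biUnion.2
            ⟨P y, Finset.mem_filter.2 ⟨(hP y).1, hl⟩, (hP y).2⟩)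
      exact ⟨P x₁, P y₁, P y₂, legal_of_good hQ (hP x₁).1 (hP y₁).1 (hP y₂).1 (hP x₁).2
        (he ▸ (hP x₂).2) hx hxc (hP y₁).2 (hP y₂).2 (hD y₁ hb₁).1 (hD y₂ hb₂).1 hd
        (hD y₁ hb₁).2 (hD y₂ hb₂).2⟩
    have h := Set.ncard_le_ncard hsub (Set.toFinite _)
    rw [Set.ncard_coe_finset, Finset.card_image_of_injective, Finset.card_sigma] at h
    · refine le_trans ?_ (Nat.add_le_add_right h _)
      rw [← hL, ← smul_eq_mul, ← smul_eq_mul (a := (loopPairs P).card)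
        (b := Mtot k * _), ← Finset.sum_const, ← Finset.sum_const,
        ← Finset.sum_add_distrib]
      refine Finset.sum_le_sum fun t _ => ?_
      have := card_goodPairs hc hP hu (hP t.1).1
      rwa [hnl] at this
    · rintro ⟨a, b⟩ ⟨a', b'⟩ h
      have := hinj h
      simp only [Prod.mk.injEq] at this
      obtain ⟨rfl, rfl⟩ := this
      rfl

/-- the number of legal ℓ-switchings from `Q ∈ C_ℓ` is
`2ℓM²(1 + O((k_max² + ℓ)/M))` (equation (5) of the paper). -/
theorem legal_forward_switching_count (r : ℕ) (hr : 3 ≤ r) :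
    ∃ C δ : ℝ, 0 < C ∧ 0 < δ ∧
      ∀ (n : ℕ) (k : Fin n → ℕ) (ℓ : ℕ) (Q : Finset (Finset (Pts k))),
        r ∣ Mtot k → 2 ≤ kmax k → (kmax k : ℝ) ^ 3 ≤ δ * (Mtot k : ℝ) →
        1 ≤ ℓ → ℓ ≤ Nbound r k → Q ∈ Cset r k ℓ →
        ∃ E : ℝ, |E| ≤ C * ((kmax k : ℝ) ^ 2 + (ℓ : ℝ)) / (Mtot k : ℝ) ∧
          (Set.ncard (legalForwardTuples r k ℓ Q) : ℝ) =
            2 * (ℓ : ℝ) * (Mtot k : ℝ) ^ 2 * (1 + E) := by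
  refine ⟨3 * (r : ℝ) ^ 3, 1, by positivity, one_pos, ?_⟩
  intro n k ℓ Q _ hk _ hℓ _ hQ
  obtain ⟨hub, hlb⟩ := ncard_bounds hQ
  have hM : 0 < Mtot k := by
    by_contra h0
    have h0 : Mtot k = 0 := by omega
    have : kmax k ≤ 0 := by
      refine Finset.sup_le fun i hi => ?_
      exact (Finset.sum_eq_zero_iff.1 h0 i hi).le
    omega
  generalize Set.ncard (legalForwardTuples r k ℓ Q) = c at hub hlb ⊢
  have hub' : (c : ℝ) ≤ 2 * ℓ * (Mtot k : ℝ) ^ 2 := by exact_mod_cast hub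
  have hlb' : 2 * ℓ * (Mtot k : ℝ) ^ 2 ≤ c + 2 * ℓ * (Mtot k *
      (2 * (r ^ 3 * (kmax k : ℝ) ^ 2 + ℓ * r) + r * kmax k * r)) := by exact_mod_cast hlb
  have hMr : (0 : ℝ) < Mtot k := by exact_mod_cast hM
  have hℓr : (1 : ℝ) ≤ ℓ := by exact_mod_cast hℓ
  have hkr : (2 : ℝ) ≤ kmax k := by exact_mod_cast hk
  have hrr : (3 : ℝ) ≤ r := by exact_mod_cast hr
  generalize (Mtot k : ℝ) = M at *
  generalize (kmax k : ℝ) = K at *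
  generalize (ℓ : ℝ) = L at *
  generalize (r : ℝ) = R at *
  generalize (c : ℝ) = c at *
  have hpos : 0 < 2 * L * M ^ 2 := by positivity
  refine ⟨c / (2 * L * M ^ 2) - 1, ?_, by field_simp; ring⟩
  have hb : 2 * (R ^ 3 * K ^ 2 + L * R) + R * K * R ≤ 3 * R ^ 3 * (K ^ 2 + L) := by
    have a1 : R * K * R ≤ R ^ 3 * K ^ 2 := by
      have : 1 ≤ R * K := by nlinarith
      calc R * K * R ≤ (R * K * R) * (R * K) := le_mul_of_one_le_right (by positivity) this
        _ = _ := by ring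
    have a2 : L * R ≤ L * R ^ 3 := by
      gcongr
      exact le_self_pow₀ (by linarith) (by norm_num)
    have a3 : 0 ≤ L * R ^ 3 := by positivity
    nlinarith
  have hB : 2 * L * (M * (2 * (R ^ 3 * K ^ 2 + L * R) + R * K * R)) ≤
      2 * L * (M * (3 * R ^ 3 * (K ^ 2 + L))) := by gcongr
  have hcle : c / (2 * L * M ^ 2) ≤ 1 := (div_le_one hpos).2 hub'
  rw [abs_of_nonpos (by linarith)]
  have : 1 - 3 * R ^ 3 * (K ^ 2 + L) / M ≤ c / (2 * L * M ^ 2) := by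
    rw [le_div_iff₀ hpos]
    have : (1 - 3 * R ^ 3 * (K ^ 2 + L) / M) * (2 * L * M ^ 2) =
        2 * L * M ^ 2 - 2 * L * (M * (3 * R ^ 3 * (K ^ 2 + L))) := by
      field_simp
    rw [this]; linarith
  linarith
end

section
/- Let r ≥ 3 be fixed. There exist constants δ > 0 and M_0 depending only on r such that for every degree sequence k with sum M ≥ M_0 divisible by r, k_max ≥ 2 and k_max^3 ≤ δM, the following holds: for every integer ℓ with 1 ≤ ℓ ≤ N, every Q ∈ C_ℓ admits at least one legal ℓ-switching; consequently, if C_ℓ is nonempty then C_{ℓ−1} is nonempty. -/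
open scoped Classical BigOperators

section Helpers

variable {n : ℕ} {k : Fin n → ℕ}

lemma mem_vset_aux {U : Finset (Pts k)} {i : Fin n} : i ∈ vset U ↔ ∃ p ∈ U, p.1 = i := by
  simp only [vset, Finset.mem_image]

lemma vset_card_le_aux (U : Finset (Pts k)) : (vset U).card ≤ U.card := Finset.card_image_le

lemma touching_le_aux {r : ℕ} {Q : Finset (Finset (Pts k))} (hQ : IsPartition r k Q)
    (S : Finset (Fin n)) :
    (Q.filter fun W => ¬ Disjoint (vset W) S).card ≤ S.card * kmax k := by
  choose f hf hu using fun p => (hQ.2 p)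
  have hsub : (Q.filter fun W => ¬ Disjoint (vset W) S) ⊆
      S.biUnion (fun i => (Finset.univ : Finset (Fin (k i))).image (fun a => f ⟨i, a⟩)) := by
    intro W hW
    rw [Finset.mem_filter, Finset.not_disjoint_iff] at hW
    obtain ⟨hWQ, i, hi, hiS⟩ := hW
    obtain ⟨⟨j, a⟩, hp, rfl⟩ := mem_vset_aux.1 hi
    rw [Finset.mem_biUnion]
    exact ⟨j, hiS, Finset.mem_image.2 ⟨a, Finset.mem_univ _, (hu ⟨j, a⟩ W ⟨hWQ, hp⟩).symm⟩⟩
  refine (Finset.card_le_card hsub).trans (Finset.card_biUnion_le_card_mul _ _ _ ?_)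
  intro i _
  refine Finset.card_image_le.trans ?_
  rw [Finset.card_univ, Fintype.card_fin]
  exact Finset.le_sup (f := k) (Finset.mem_univ i)

lemma Mtot_le_aux {r : ℕ} {Q : Finset (Finset (Pts k))} (hQ : IsPartition r k Q) :
    Mtot k ≤ Q.card * r := by
  have h1 : (Finset.univ : Finset (Pts k)).card = Mtot k := by
    simp [Mtot]
  rw [← h1]
  have h2 : (Finset.univ : Finset (Pts k)) ⊆ Q.biUnion id := by
    intro p _
    obtain ⟨U, hU, _⟩ := hQ.2 p
    exact Finset.mem_biUnion.2 ⟨U, hU.1, hU.2⟩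
  exact (Finset.card_le_card h2).trans
    (Finset.card_biUnion_le_card_mul _ _ _ fun U hU => (hQ.1 U hU).le)

lemma mult_le_one_aux {U : Finset (Pts k)} (h : ¬ HasLoop U) (i : Fin n) : mult U i ≤ 1 := by
  rw [mult, Finset.card_le_one]
  intro a ha b hb
  rw [Finset.mem_filter] at ha hb
  by_contra hne
  exact h ⟨a, ha.1, b, hb.1, hne, ha.2.trans hb.2.symm⟩

lemma M2_le_aux (k : Fin n → ℕ) : M2 k ≤ kmax k * Mtot k := by
  rw [M2, Mtot, Finset.mul_sum]
  refine Finset.sum_le_sum fun i _ => ?_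
  rw [mul_comm]
  exact Nat.mul_le_mul_right _ ((Nat.sub_le _ _).trans (Finset.le_sup (f := k) (Finset.mem_univ i)))

/-- An arithmetic bound on `N`. -/
lemma Nbound_le_aux (r : ℕ) (hr : 3 ≤ r) (k : Fin n → ℕ) (hM : 1 ≤ Mtot k) :
    (Nbound r k : ℝ) ≤ Real.log (Mtot k) + 9 * r * kmax k + 1 := by
  have hM' : (1 : ℝ) ≤ Mtot k := by exact_mod_cast hM
  have hr' : (3 : ℝ) ≤ r := by exact_mod_cast hr
  have hlog : 0 ≤ Real.log (Mtot k) := Real.log_nonneg hM'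
  have hK : (0 : ℝ) ≤ kmax k := by positivity
  have hpos : (0 : ℝ) ≤ 9 * r * kmax k := by positivity
  rw [Nbound, Nat.cast_max, max_le_iff]
  constructor
  · have := (Nat.ceil_lt_add_one hlog).le
    linarith
  · have h0 : (0 : ℝ) ≤ (9 * ((r : ℝ) - 1) * (M2 k : ℝ)) / (Mtot k : ℝ) := by
      have : (0 : ℝ) ≤ (r : ℝ) - 1 := by linarith
      positivity
    have h1 := (Nat.ceil_lt_add_one h0).le
    have h2 : (9 * ((r : ℝ) - 1) * (M2 k : ℝ)) / (Mtot k : ℝ) ≤ 9 * r * kmax k := by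
      rw [div_le_iff₀ (by linarith)]
      have hM2 : (M2 k : ℝ) ≤ kmax k * Mtot k := by exact_mod_cast M2_le_aux k
      have h3 : 9 * ((r : ℝ) - 1) * (M2 k : ℝ) ≤ 9 * r * (kmax k * Mtot k) := by
        apply mul_le_mul _ hM2 (by positivity) (by positivity)
        linarith
      linarith
    linarith

set_option maxHeartbeats 1000000 in
/-- The combinatorial heart: switching with sufficiently generic parts is legal. -/
lemma legal_aux {r ℓ : ℕ} (hr : 3 ≤ r) {Q : Finset (Finset (Pts k))} (hQ : Q ∈ Cset r k ℓ)
    {U W₁ W₂ : Finset (Pts k)} {x₁ x₂ y₁ y₂ : Pts k}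
    (hU : U ∈ Q) (hW₁ : W₁ ∈ Q) (hW₂ : W₂ ∈ Q)
    (hx₁ : x₁ ∈ U) (hx₂ : x₂ ∈ U) (hx : x₁ ≠ x₂) (hxx : x₁.1 = x₂.1)
    (hy₁ : y₁ ∈ W₁) (hy₂ : y₂ ∈ W₂)
    (hl₁ : ¬ HasLoop W₁) (hl₂ : ¬ HasLoop W₂)
    (hd : Disjoint (vset W₁) (vset W₂))
    (hs₁ : ∀ Z ∈ Q, ¬ Disjoint (vset Z) (vset U) → Disjoint (vset W₁) (vset Z))
    (hs₂ : ∀ Z ∈ Q, ¬ Disjoint (vset Z) (vset U) → Disjoint (vset W₂) (vset Z)) :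
    IsSwitching Q U W₁ W₂ x₁ x₂ y₁ y₂ ∧
            switchResult Q U W₁ W₂ x₁ x₂ y₁ y₂ ∈ Cset r k (ℓ - 1) := by
  obtain ⟨⟨hP, h1, h2, h3, h4⟩, hℓ⟩ := hQ
  have mv : ∀ {V : Finset (Pts k)} {p : Pts k}, p ∈ V → p.1 ∈ vset V :=
    fun hp => mem_vset_aux.2 ⟨_, hp, rfl⟩
  have hLU : HasLoop U := ⟨x₁, hx₁, x₂, hx₂, hx, hxx⟩
  have hUW₁ : U ≠ W₁ := fun h => hl₁ (h ▸ hLU)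
  have hUW₂ : U ≠ W₂ := fun h => hl₂ (h ▸ hLU)
  have hW : W₁ ≠ W₂ := by
    rintro rfl
    exact Finset.disjoint_left.1 hd (mv hy₁) (mv hy₁)
  have hc : y₁.1 ≠ y₂.1 := fun h => Finset.disjoint_left.1 hd (mv hy₁) (h ▸ mv hy₂)
  have hUU : ¬ Disjoint (vset U) (vset U) := fun h => Finset.disjoint_left.1 h (mv hx₁) (mv hx₁)
  have dU₁ : Disjoint (vset W₁) (vset U) := hs₁ U hU hUU
  have dU₂ : Disjoint (vset W₂) (vset U) := hs₂ U hU hUU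
  -- points in different parts
  have n₁ : ∀ p ∈ W₁, ∀ q ∈ U, p.1 ≠ q.1 := fun p hp q hq h =>
    Finset.disjoint_left.1 dU₁ (mv hp) (h ▸ mv hq)
  have n₂ : ∀ p ∈ W₂, ∀ q ∈ U, p.1 ≠ q.1 := fun p hp q hq h =>
    Finset.disjoint_left.1 dU₂ (mv hp) (h ▸ mv hq)
  have n₃ : ∀ p ∈ W₁, ∀ q ∈ W₂, p.1 ≠ q.1 := fun p hp q hq h =>
    Finset.disjoint_left.1 hd (mv hp) (h ▸ mv hq)
  have y₁U : y₁ ∉ U := fun h => n₁ _ hy₁ _ h rfl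
  have y₂U : y₂ ∉ U := fun h => n₂ _ hy₂ _ h rfl
  have x₁W : x₁ ∉ W₁ := fun h => n₁ _ h _ hx₁ rfl
  have x₂W : x₂ ∉ W₂ := fun h => n₂ _ h _ hx₂ rfl
  -- the only loop of U
  have hUl : ∀ p ∈ U, ∀ q ∈ U, p ≠ q → p.1 = q.1 → p.1 = x₁.1 := by
    have two : ∀ p ∈ U, ∀ q ∈ U, p ≠ q → p.1 = q.1 → mult U p.1 = 2 := by
      intro p hp q hq hpq he
      refine le_antisymm (h1 U hU _) ?_
      rw [mult, ← Finset.card_pair hpq]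
      apply Finset.card_le_card
      intro z hz
      rw [Finset.mem_insert, Finset.mem_singleton] at hz
      rcases hz with rfl | rfl
      · exact Finset.mem_filter.2 ⟨hp, rfl⟩
      · exact Finset.mem_filter.2 ⟨hq, he.symm⟩
    intro p hp q hq hpq he
    exact h2 U hU _ _ (two p hp q hq hpq he) (two x₁ hx₁ x₂ hx₂ hx hxx)
  have hUx : ∀ p ∈ U, p.1 = x₁.1 → p = x₁ ∨ p = x₂ := by
    intro p hp he
    by_contra hcon
    push Not at hcon
    have h5 := h1 U hU x₁.1
    have h6 : ({p, x₁, x₂} : Finset (Pts k)).card = 3 :=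
      Finset.card_eq_three.2 ⟨p, x₁, x₂, hcon.1, hcon.2, hx, rfl⟩
    have h7 : ({p, x₁, x₂} : Finset (Pts k)) ⊆ U.filter fun q => q.1 = x₁.1 := by
      intro z hz
      simp only [Finset.mem_insert, Finset.mem_singleton] at hz
      rw [Finset.mem_filter]
      rcases hz with rfl | rfl | rfl
      · exact ⟨hp, he⟩
      · exact ⟨hx₁, rfl⟩
      · exact ⟨hx₂, hxx.symm⟩
    have h8 := Finset.card_le_card h7
    rw [mult] at h5
    omega
  set Uh := (U \ {x₁, x₂}) ∪ {y₁, y₂} with hUh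
  set V₁ := (W₁ \ {y₁}) ∪ {x₁} with hV₁
  set V₂ := (W₂ \ {y₂}) ∪ {x₂} with hV₂
  have mUh : ∀ p, p ∈ Uh ↔ (p ∈ U ∧ p ≠ x₁ ∧ p ≠ x₂) ∨ p = y₁ ∨ p = y₂ := by
    intro p; simp [hUh]; tauto
  have mV₁ : ∀ p, p ∈ V₁ ↔ (p ∈ W₁ ∧ p ≠ y₁) ∨ p = x₁ := by
    intro p; simp [hV₁]; tauto
  have mV₂ : ∀ p, p ∈ V₂ ↔ (p ∈ W₂ ∧ p ≠ y₂) ∨ p = x₂ := by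
    intro p; simp [hV₂]; tauto
  -- no loops in new parts
  have lU : ¬ HasLoop Uh := by
    rintro ⟨p, hp, q, hq, hpq, he⟩
    rw [mUh] at hp hq
    rcases hp with ⟨hp, hp1, hp2⟩ | rfl | rfl <;> rcases hq with ⟨hq, hq1, hq2⟩ | rfl | rfl
    · rcases hUx p hp (hUl p hp q hq hpq he) with h | h
      · exact hp1 h
      · exact hp2 h
    · exact n₁ _ hy₁ _ hp he.symm
    · exact n₂ _ hy₂ _ hp he.symm
    · exact n₁ _ hy₁ _ hq he
    · exact hpq rfl
    · exact hc he
    · exact n₂ _ hy₂ _ hq he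
    · exact hc he.symm
    · exact hpq rfl
  have l₁ : ¬ HasLoop V₁ := by
    rintro ⟨p, hp, q, hq, hpq, he⟩
    rw [mV₁] at hp hq
    rcases hp with ⟨hp, hp1⟩ | rfl <;> rcases hq with ⟨hq, hq1⟩ | rfl
    · exact hl₁ ⟨p, hp, q, hq, hpq, he⟩
    · exact n₁ _ hp _ hx₁ he
    · exact n₁ _ hq _ hx₁ he.symm
    · exact hpq rfl
  have l₂ : ¬ HasLoop V₂ := by
    rintro ⟨p, hp, q, hq, hpq, he⟩
    rw [mV₂] at hp hq
    rcases hp with ⟨hp, hp1⟩ | rfl <;> rcases hq with ⟨hq, hq1⟩ | rfl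
    · exact hl₂ ⟨p, hp, q, hq, hpq, he⟩
    · exact n₂ _ hp _ hx₂ he
    · exact n₂ _ hq _ hx₂ he.symm
    · exact hpq rfl
  -- vertex sets of new parts
  have vU : vset Uh ⊆ vset U ∪ {y₁.1, y₂.1} := by
    intro i hi
    obtain ⟨p, hp, rfl⟩ := mem_vset_aux.1 hi
    rw [mUh] at hp
    rcases hp with ⟨hp, -⟩ | rfl | rfl
    · exact Finset.mem_union_left _ (mv hp)
    · simp
    · simp
  have vUx : x₁.1 ∉ vset Uh := by
    intro hi
    obtain ⟨p, hp, hpe⟩ := mem_vset_aux.1 hi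
    rw [mUh] at hp
    rcases hp with ⟨hp, hp1, hp2⟩ | rfl | rfl
    · rcases hUx p hp hpe with h | h
      · exact hp1 h
      · exact hp2 h
    · exact n₁ _ hy₁ _ hx₁ hpe
    · exact n₂ _ hy₂ _ hx₁ hpe
  have v₁ : vset V₁ ⊆ insert x₁.1 (vset W₁) := by
    intro i hi
    obtain ⟨p, hp, rfl⟩ := mem_vset_aux.1 hi
    rw [mV₁] at hp
    rcases hp with ⟨hp, -⟩ | rfl
    · exact Finset.mem_insert_of_mem (mv hp)
    · simp
  have v₂ : vset V₂ ⊆ insert x₁.1 (vset W₂) := by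
    intro i hi
    obtain ⟨p, hp, rfl⟩ := mem_vset_aux.1 hi
    rw [mV₂] at hp
    rcases hp with ⟨hp, -⟩ | rfl
    · exact Finset.mem_insert_of_mem (mv hp)
    · simp [hxx]
  -- pairwise intersections
  have iUold : ∀ Z ∈ Q, Z ≠ U → (vset Uh ∩ vset Z).card ≤ 2 := by
    intro Z hZ hZU
    by_cases hdz : Disjoint (vset Z) (vset U)
    · refine (Finset.card_le_card (t := {y₁.1, y₂.1}) ?_).trans Finset.card_le_two
      intro i hi
      rw [Finset.mem_inter] at hi
      rcases Finset.mem_union.1 (vU hi.1) with h | h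
      · exact absurd h (Finset.disjoint_left.1 hdz hi.2)
      · exact h
    · refine (Finset.card_le_card ?_).trans (h3 U hU Z hZ hZU.symm)
      intro i hi
      rw [Finset.mem_inter] at hi ⊢
      refine ⟨?_, hi.2⟩
      rcases Finset.mem_union.1 (vU hi.1) with h | h
      · exact h
      · exfalso
        simp only [Finset.mem_insert, Finset.mem_singleton] at h
        rcases h with rfl | rfl
        · exact Finset.disjoint_left.1 (hs₁ Z hZ hdz) (mv hy₁) hi.2
        · exact Finset.disjoint_left.1 (hs₂ Z hZ hdz) (mv hy₂) hi.2
  have iold : ∀ (V W : Finset (Pts k)), W ∈ Q → vset V ⊆ insert x₁.1 (vset W) →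
      (∀ Z ∈ Q, ¬ Disjoint (vset Z) (vset U) → Disjoint (vset W) (vset Z)) →
      ∀ Z ∈ Q, Z ≠ W → (vset V ∩ vset Z).card ≤ 2 := by
    intro V W hWQ hv hs Z hZ hZW
    by_cases hxz : x₁.1 ∈ vset Z
    · have hdz := hs Z hZ (fun h => Finset.disjoint_left.1 h hxz (mv hx₁))
      refine (Finset.card_le_card (t := {x₁.1}) ?_).trans (by simp)
      intro i hi
      rw [Finset.mem_inter] at hi
      rcases Finset.mem_insert.1 (hv hi.1) with h | h
      · simp [h]
      · exact absurd hi.2 (Finset.disjoint_left.1 hdz h)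
    · refine (Finset.card_le_card ?_).trans (h3 W hWQ Z hZ hZW.symm)
      intro i hi
      rw [Finset.mem_inter] at hi ⊢
      refine ⟨?_, hi.2⟩
      rcases Finset.mem_insert.1 (hv hi.1) with h | h
      · exact absurd (h ▸ hi.2) hxz
      · exact h
  have i₁old := iold V₁ W₁ hW₁ v₁ hs₁
  have i₂old := iold V₂ W₂ hW₂ v₂ hs₂
  have iU : ∀ (V W : Finset (Pts k)), vset V ⊆ insert x₁.1 (vset W) →
      Disjoint (vset W) (vset U) → (vset Uh ∩ vset V).card ≤ 2 := by
    intro V W hv hdw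
    refine (Finset.card_le_card (t := {y₁.1, y₂.1}) ?_).trans Finset.card_le_two
    intro i hi
    rw [Finset.mem_inter] at hi
    rcases Finset.mem_union.1 (vU hi.1) with h | h
    · exfalso
      rcases Finset.mem_insert.1 (hv hi.2) with h' | h'
      · exact vUx (h' ▸ hi.1)
      · exact Finset.disjoint_left.1 hdw h' h
    · exact h
  have iU₁ := iU V₁ W₁ v₁ dU₁
  have iU₂ := iU V₂ W₂ v₂ dU₂
  have i₁₂ : (vset V₁ ∩ vset V₂).card ≤ 2 := by
    refine (Finset.card_le_card (t := {x₁.1}) ?_).trans (by simp)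
    intro i hi
    rw [Finset.mem_inter] at hi
    rcases Finset.mem_insert.1 (v₁ hi.1) with h | h
    · simp [h]
    · rcases Finset.mem_insert.1 (v₂ hi.2) with h' | h'
      · simp [h']
      · exact absurd h' (Finset.disjoint_left.1 hd h)
  have mQ : ∀ Z, Z ∈ switchResult Q U W₁ W₂ x₁ x₂ y₁ y₂ ↔
      (Z ∈ Q ∧ Z ≠ U ∧ Z ≠ W₁ ∧ Z ≠ W₂) ∨ Z = Uh ∨ Z = V₁ ∨ Z = V₂ := by
    intro Z
    rw [switchResult, ← hUh, ← hV₁, ← hV₂]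
    simp only [Finset.mem_union, Finset.mem_sdiff, Finset.mem_insert, Finset.mem_singleton,
      not_or, ne_eq]
  have hnl : nloops (switchResult Q U W₁ W₂ x₁ x₂ y₁ y₂) = ℓ - 1 := by
    have : (switchResult Q U W₁ W₂ x₁ x₂ y₁ y₂).filter (fun Z => HasLoop Z) =
        (Q.filter fun Z => HasLoop Z).erase U := by
      ext Z
      rw [Finset.mem_filter, mQ, Finset.mem_erase, Finset.mem_filter]
      constructor
      · rintro ⟨⟨ha, hb, -⟩ | rfl | rfl | rfl, hz⟩
        · exact ⟨hb, ha, hz⟩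
        · exact absurd hz lU
        · exact absurd hz l₁
        · exact absurd hz l₂
      · rintro ⟨ha, hb, hz⟩
        refine ⟨Or.inl ⟨hb, ha, ?_, ?_⟩, hz⟩
        · rintro rfl; exact hl₁ hz
        · rintro rfl; exact hl₂ hz
    rw [nloops, this, Finset.card_erase_of_mem (Finset.mem_filter.2 ⟨hU, hLU⟩), ← hℓ, nloops]
  have uniq : ∀ {p : Pts k} {A B : Finset (Pts k)}, A ∈ Q → B ∈ Q → p ∈ A → p ∈ B → A = B :=
    fun {p A B} hA hB ha hb => (hP.2 p).unique ⟨hA, ha⟩ ⟨hB, hb⟩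
  refine ⟨⟨hU, hW₁, hW₂, hUW₁, hUW₂, hW, hx₁, hx₂, hx, hxx, hy₁, hy₂, hc⟩,
    ⟨⟨?_, ?_⟩, ?_, ?_, ?_, ?_⟩, hnl⟩
  · intro Z hZ
    rw [mQ] at hZ
    have hyy : y₁ ≠ y₂ := fun h => hc (by rw [h])
    rcases hZ with ⟨hZ, -⟩ | rfl | rfl | rfl
    · exact hP.1 Z hZ
    · have e1 : Disjoint (U \ {x₁, x₂}) {y₁, y₂} := by
        rw [Finset.disjoint_left]
        intro a ha hb
        simp only [Finset.mem_insert, Finset.mem_singleton] at hb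
        rcases hb with rfl | rfl
        · exact y₁U (Finset.mem_sdiff.1 ha).1
        · exact y₂U (Finset.mem_sdiff.1 ha).1
      have e2 : ({x₁, x₂} : Finset (Pts k)) ⊆ U := by
        intro a ha
        simp only [Finset.mem_insert, Finset.mem_singleton] at ha
        rcases ha with rfl | rfl <;> assumption
      rw [hUh, Finset.card_union_of_disjoint e1, Finset.card_sdiff_of_subset e2,
        Finset.card_pair hx, Finset.card_pair hyy, hP.1 U hU]
      omega
    · have e1 : Disjoint (W₁ \ {y₁}) {x₁} := by
        rw [Finset.disjoint_singleton_right]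
        exact fun h => x₁W (Finset.mem_sdiff.1 h).1
      rw [hV₁, Finset.card_union_of_disjoint e1,
        Finset.card_sdiff_of_subset (Finset.singleton_subset_iff.2 hy₁),
        Finset.card_singleton, Finset.card_singleton, hP.1 _ hW₁]
      omega
    · have e1 : Disjoint (W₂ \ {y₂}) {x₂} := by
        rw [Finset.disjoint_singleton_right]
        exact fun h => x₂W (Finset.mem_sdiff.1 h).1
      rw [hV₂, Finset.card_union_of_disjoint e1,
        Finset.card_sdiff_of_subset (Finset.singleton_subset_iff.2 hy₂),
        Finset.card_singleton, Finset.card_singleton, hP.1 _ hW₂]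
      omega
  · intro p
    -- membership of `p` in each of the old parts determines everything
    have q₁ : p ∈ U → p ∉ W₁ := fun a b => hUW₁ (uniq hU hW₁ a b)
    have q₂ : p ∈ U → p ∉ W₂ := fun a b => hUW₂ (uniq hU hW₂ a b)
    have q₃ : p ∈ W₁ → p ∉ W₂ := fun a b => hW (uniq hW₁ hW₂ a b)
    have r₁ : p = x₁ → p ∈ U := by rintro rfl; exact hx₁
    have r₂ : p = x₂ → p ∈ U := by rintro rfl; exact hx₂
    have r₃ : p = y₁ → p ∈ W₁ := by rintro rfl; exact hy₁
    have r₄ : p = y₂ → p ∈ W₂ := by rintro rfl; exact hy₂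
    have r₅ : p = x₁ → p ≠ x₂ := by rintro rfl; exact hx
    have old : ∀ A ∈ Q, A ≠ U → A ≠ W₁ → A ≠ W₂ → p ∈ A → p ∉ Uh ∧ p ∉ V₁ ∧ p ∉ V₂ := by
      intro A hA a1 a2 a3 hp
      have b1 : p ∉ U := fun h => a1 (uniq hA hU hp h)
      have b2 : p ∉ W₁ := fun h => a2 (uniq hA hW₁ hp h)
      have b3 : p ∉ W₂ := fun h => a3 (uniq hA hW₂ hp h)
      rw [mUh, mV₁, mV₂]
      refine ⟨?_, ?_, ?_⟩
      · rintro (h | h | h)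
        · exact b1 h.1
        · exact b2 (r₃ h)
        · exact b3 (r₄ h)
      · rintro (h | h)
        · exact b2 h.1
        · exact b1 (r₁ h)
      · rintro (h | h)
        · exact b3 h.1
        · exact b1 (r₂ h)
    have ex1 : p ∈ Uh → p ∉ V₁ ∧ p ∉ V₂ := by
      rw [mUh, mV₁, mV₂]
      rintro (⟨hu, hn1, hn2⟩ | h | h) <;> constructor <;> rintro (⟨a, ha⟩ | a)
      · exact q₁ hu a
      · exact hn1 a
      · exact q₂ hu a
      · exact hn2 a
      · exact ha h
      · exact q₁ (r₁ a) (r₃ h)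
      · exact q₃ (r₃ h) a
      · exact q₁ (r₂ a) (r₃ h)
      · exact q₃ a (r₄ h)
      · exact q₂ (r₁ a) (r₄ h)
      · exact ha h
      · exact q₂ (r₂ a) (r₄ h)
    have ex2 : p ∈ V₁ → p ∉ V₂ := by
      rw [mV₁, mV₂]
      rintro (⟨a, -⟩ | a) <;> rintro (⟨b, -⟩ | b)
      · exact q₃ a b
      · exact q₁ (r₂ b) a
      · exact q₂ (r₁ a) b
      · exact r₅ a b
    have huniq : ∀ A ∈ switchResult Q U W₁ W₂ x₁ x₂ y₁ y₂, p ∈ A →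
        ∀ B ∈ switchResult Q U W₁ W₂ x₁ x₂ y₁ y₂, p ∈ B → A = B := by
      intro A hA hpA B hB hpB
      rw [mQ] at hA hB
      rcases hA with ⟨hA, a1, a2, a3⟩ | rfl | rfl | rfl <;>
        rcases hB with ⟨hB, b1, b2, b3⟩ | rfl | rfl | rfl
      · exact uniq hA hB hpA hpB
      · exact absurd hpB (old A hA a1 a2 a3 hpA).1
      · exact absurd hpB (old A hA a1 a2 a3 hpA).2.1
      · exact absurd hpB (old A hA a1 a2 a3 hpA).2.2
      · exact absurd hpA (old B hB b1 b2 b3 hpB).1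
      · rfl
      · exact absurd hpB (ex1 hpA).1
      · exact absurd hpB (ex1 hpA).2
      · exact absurd hpA (old B hB b1 b2 b3 hpB).2.1
      · exact absurd hpA (ex1 hpB).1
      · rfl
      · exact absurd hpB (ex2 hpA)
      · exact absurd hpA (old B hB b1 b2 b3 hpB).2.2
      · exact absurd hpA (ex1 hpB).2
      · exact absurd hpA (ex2 hpB)
      · rfl
    have hex : ∃ A ∈ switchResult Q U W₁ W₂ x₁ x₂ y₁ y₂, p ∈ A := by
      have gU : p ∈ Uh → ∃ A ∈ switchResult Q U W₁ W₂ x₁ x₂ y₁ y₂, p ∈ A := fun h =>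
        ⟨Uh, (mQ _).2 (Or.inr (Or.inl rfl)), h⟩
      have g₁ : p ∈ V₁ → ∃ A ∈ switchResult Q U W₁ W₂ x₁ x₂ y₁ y₂, p ∈ A := fun h =>
        ⟨V₁, (mQ _).2 (Or.inr (Or.inr (Or.inl rfl))), h⟩
      have g₂ : p ∈ V₂ → ∃ A ∈ switchResult Q U W₁ W₂ x₁ x₂ y₁ y₂, p ∈ A := fun h =>
        ⟨V₂, (mQ _).2 (Or.inr (Or.inr (Or.inr rfl))), h⟩
      rw [mUh] at gU
      rw [mV₁] at g₁
      rw [mV₂] at g₂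
      obtain ⟨A, ⟨hA, hpA⟩, -⟩ := hP.2 p
      by_cases a1 : A = U
      · rw [a1] at hpA
        by_cases c1 : p = x₁
        · exact g₁ (Or.inr c1)
        by_cases c2 : p = x₂
        · exact g₂ (Or.inr c2)
        exact gU (Or.inl ⟨hpA, c1, c2⟩)
      by_cases a2 : A = W₁
      · rw [a2] at hpA
        by_cases c1 : p = y₁
        · exact gU (Or.inr (Or.inl c1))
        exact g₁ (Or.inl ⟨hpA, c1⟩)
      by_cases a3 : A = W₂
      · rw [a3] at hpA
        by_cases c1 : p = y₂
        · exact gU (Or.inr (Or.inr c1))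
        exact g₂ (Or.inl ⟨hpA, c1⟩)
      exact ⟨A, (mQ _).2 (Or.inl ⟨hA, a1, a2, a3⟩), hpA⟩
    obtain ⟨A, hA, hpA⟩ := hex
    exact ⟨A, ⟨hA, hpA⟩, fun B hB => huniq B hB.1 hB.2 A hA hpA⟩
  · intro Z hZ i
    rw [mQ] at hZ
    rcases hZ with ⟨hZ, -⟩ | rfl | rfl | rfl
    · exact h1 Z hZ i
    · exact (mult_le_one_aux lU i).trans one_le_two
    · exact (mult_le_one_aux l₁ i).trans one_le_two
    · exact (mult_le_one_aux l₂ i).trans one_le_two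
  · intro Z hZ i j hi hj
    rw [mQ] at hZ
    rcases hZ with ⟨hZ, -⟩ | rfl | rfl | rfl
    · exact h2 Z hZ i j hi hj
    · have := mult_le_one_aux lU i; omega
    · have := mult_le_one_aux l₁ i; omega
    · have := mult_le_one_aux l₂ i; omega
  · intro A hA B hB hAB
    rw [mQ] at hA hB
    rcases hA with ⟨hA, a1, a2, a3⟩ | rfl | rfl | rfl <;>
      rcases hB with ⟨hB, b1, b2, b3⟩ | rfl | rfl | rfl
    · exact h3 A hA B hB hAB
    · rw [Finset.inter_comm]; exact iUold A hA a1
    · rw [Finset.inter_comm]; exact i₁old A hA a2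
    · rw [Finset.inter_comm]; exact i₂old A hA a3
    · exact iUold B hB b1
    · exact absurd rfl hAB
    · exact iU₁
    · exact iU₂
    · exact i₁old B hB b2
    · rw [Finset.inter_comm]; exact iU₁
    · exact absurd rfl hAB
    · exact i₁₂
    · exact i₂old B hB b3
    · rw [Finset.inter_comm]; exact iU₂
    · rw [Finset.inter_comm]; exact i₁₂
    · exact absurd rfl hAB
  · rw [hnl]; omega

/-- A legal switching exists as soon as there are sufficiently many parts. -/
lemma exists_aux {r ℓ : ℕ} (hr : 3 ≤ r) (hℓ : 1 ≤ ℓ) {Q : Finset (Finset (Pts k))}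
    (hQ : Q ∈ Cset r k ℓ)
    (hbig : Nbound r k + r * kmax k * r * kmax k + r * kmax k < Q.card) :
    ∃ (U W₁ W₂ : Finset (Pts k)) (x₁ x₂ y₁ y₂ : Pts k),
            IsSwitching Q U W₁ W₂ x₁ x₂ y₁ y₂ ∧
            switchResult Q U W₁ W₂ x₁ x₂ y₁ y₂ ∈ Cset r k (ℓ - 1) := by
  have hP : IsPartition r k Q := hQ.1.1
  have hN : nloops Q ≤ Nbound r k := hQ.1.2.2.2.2
  have hl : nloops Q = ℓ := hQ.2
  obtain ⟨U, hU⟩ : (Q.filter fun U => HasLoop U).Nonempty := by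
    rw [← Finset.card_pos]; rw [nloops] at hl; omega
  rw [Finset.mem_filter] at hU
  obtain ⟨hUQ, x₁, hx₁, x₂, hx₂, hx, hxx⟩ := hU
  have hv : ∀ Z ∈ Q, (vset Z).card ≤ r := fun Z hZ => (vset_card_le_aux Z).trans (hP.1 Z hZ).le
  set S : Finset (Fin n) := (Q.filter fun Z => ¬ Disjoint (vset Z) (vset U)).biUnion vset with hS
  have hScard : S.card ≤ r * kmax k * r := by
    refine (Finset.card_biUnion_le_card_mul _ _ r
      fun Z hZ => hv Z (Finset.mem_filter.1 hZ).1).trans ?_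
    exact Nat.mul_le_mul_right _ ((touching_le_aux hP _).trans
      (Nat.mul_le_mul_right _ (hv U hUQ)))
  have pick : ∀ T : Finset (Fin n), T.card ≤ r → ∃ W ∈ Q, ¬ HasLoop W ∧ Disjoint (vset W) S ∧
      Disjoint (vset W) T := by
    intro T hT
    by_contra hcon
    push Not at hcon
    have hsub : Q ⊆ ((Q.filter fun W => HasLoop W) ∪ (Q.filter fun W => ¬ Disjoint (vset W) S)) ∪
        (Q.filter fun W => ¬ Disjoint (vset W) T) := by
      intro W hW
      simp only [Finset.mem_union, Finset.mem_filter]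
      have := hcon W hW
      tauto
    have h1 := Finset.card_le_card hsub
    have h2 := Finset.card_union_le
      ((Q.filter fun W => HasLoop W) ∪ (Q.filter fun W => ¬ Disjoint (vset W) S))
      (Q.filter fun W => ¬ Disjoint (vset W) T)
    have h3 := Finset.card_union_le
      (Q.filter fun W => HasLoop W) (Q.filter fun W => ¬ Disjoint (vset W) S)
    have h4 : (Q.filter fun W => HasLoop W).card ≤ Nbound r k := hN
    have h5 := (touching_le_aux hP S).trans (Nat.mul_le_mul_right (kmax k) hScard)
    have h6 := (touching_le_aux hP T).trans (Nat.mul_le_mul_right (kmax k) hT)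
    omega
  obtain ⟨W₁, hW₁, hl₁, hs₁, -⟩ := pick ∅ (by simp)
  obtain ⟨W₂, hW₂, hl₂, hs₂, hd⟩ := pick (vset W₁) (hv W₁ hW₁)
  have ne : ∀ W ∈ Q, ∃ y, y ∈ W := by
    intro W hW
    have := hP.1 W hW
    exact Finset.card_pos.1 (by omega)
  obtain ⟨y₁, hy₁⟩ := ne W₁ hW₁
  obtain ⟨y₂, hy₂⟩ := ne W₂ hW₂
  have conv : ∀ W : Finset (Pts k), Disjoint (vset W) S →
      ∀ Z ∈ Q, ¬ Disjoint (vset Z) (vset U) → Disjoint (vset W) (vset Z) := by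
    intro W hW Z hZ hZU
    refine hW.mono_right ?_
    exact Finset.subset_biUnion_of_mem vset (Finset.mem_filter.2 ⟨hZ, hZU⟩)
  exact ⟨U, W₁, W₂, x₁, x₂, y₁, y₂, legal_aux hr hQ hUQ hW₁ hW₂ hx₁ hx₂ hx hxx hy₁ hy₂ hl₁ hl₂
    hd.symm (conv W₁ hs₁) (conv W₂ hs₂)⟩

end Helpers

/-- every `Q ∈ C_ℓ` admits a legal ℓ-switching, hence if `C_ℓ` is
nonempty then so is `C_{ℓ-1}`. -/
theorem exists_legal_switching (r : ℕ) (hr : 3 ≤ r) :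
    ∃ δ : ℝ, ∃ M₀ : ℕ, 0 < δ ∧
      ∀ (n : ℕ) (k : Fin n → ℕ),
        M₀ ≤ Mtot k → r ∣ Mtot k → 2 ≤ kmax k → (kmax k : ℝ) ^ 3 ≤ δ * (Mtot k : ℝ) →
        ∀ ℓ : ℕ, 1 ≤ ℓ → ℓ ≤ Nbound r k →
          (∀ Q ∈ Cset r k ℓ, ∃ (U W₁ W₂ : Finset (Pts k)) (x₁ x₂ y₁ y₂ : Pts k),
            IsSwitching Q U W₁ W₂ x₁ x₂ y₁ y₂ ∧
            switchResult Q U W₁ W₂ x₁ x₂ y₁ y₂ ∈ Cset r k (ℓ - 1)) ∧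
          ((Cset r k ℓ).Nonempty → (Cset r k (ℓ - 1)).Nonempty) := by
  have hr' : (3 : ℝ) ≤ r := by exact_mod_cast hr
  have hrpos : (0 : ℝ) < r := by linarith
  -- a threshold for `M`
  obtain ⟨M₀, hM₀⟩ : ∃ M₀ : ℕ, ∀ M : ℕ, M₀ ≤ M → (r : ℝ) * (Real.log M + 1) ≤ M / 4 := by
    have hlo := (Real.isLittleO_log_id_atTop.comp_tendsto tendsto_natCast_atTop_atTop).bound
      (show (0 : ℝ) < 1 / (8 * r) by positivity)
    obtain ⟨A, hA⟩ := Filter.eventually_atTop.1 hlo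
    refine ⟨max A (8 * r), fun M hM => ?_⟩
    have h1 := hA M ((le_max_left _ _).trans hM)
    have h2 : ((8 * r : ℕ) : ℝ) ≤ M := by exact_mod_cast (le_max_right _ _).trans hM
    push_cast at h2
    simp only [Function.comp_apply, id_eq, Real.norm_eq_abs, Nat.abs_cast] at h1
    have h3 : Real.log M ≤ 1 / (8 * r) * M := (le_abs_self _).trans h1
    have h4 : (r : ℝ) * Real.log M ≤ r * (1 / (8 * r) * M) := by gcongr
    have h5 : (r : ℝ) * (1 / (8 * r) * M) = M / 8 := by field_simp
    linarith
  refine ⟨1 / (44 * (r : ℝ) ^ 3), max M₀ 1, by positivity, ?_⟩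
  intro n k hM _ hK hK3 ℓ hℓ _
  have hM1 : 1 ≤ Mtot k := (le_max_right _ _).trans hM
  have hmain : ∀ Q ∈ Cset r k ℓ, ∃ (U W₁ W₂ : Finset (Pts k)) (x₁ x₂ y₁ y₂ : Pts k),
            IsSwitching Q U W₁ W₂ x₁ x₂ y₁ y₂ ∧
            switchResult Q U W₁ W₂ x₁ x₂ y₁ y₂ ∈ Cset r k (ℓ - 1) := by
    intro Q hQ
    apply exists_aux hr hℓ hQ
    have h1 : (Mtot k : ℝ) ≤ Q.card * r := by exact_mod_cast Mtot_le_aux hQ.1.1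
    have h2 := Nbound_le_aux r hr k hM1
    have h3 := hM₀ (Mtot k) ((le_max_left _ _).trans hM)
    have hMpos : (1 : ℝ) ≤ Mtot k := by exact_mod_cast hM1
    have hK' : (1 : ℝ) ≤ kmax k := by exact_mod_cast (one_le_two.trans hK)
    set K : ℝ := (kmax k : ℝ) with hKdef
    have e0 : (r : ℝ) ^ 3 * K ^ 3 ≤ Mtot k / 44 := by
      have : (r : ℝ) ^ 3 * K ^ 3 ≤ r ^ 3 * (1 / (44 * (r : ℝ) ^ 3) * Mtot k) := by gcongr
      refine this.trans (le_of_eq ?_)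
      field_simp
    have e1 : (r : ℝ) ^ 2 * K ≤ r ^ 3 * K ^ 3 :=
      mul_le_mul (pow_le_pow_right₀ (by linarith) (by norm_num))
        (le_self_pow₀ hK' (by norm_num)) (by linarith) (by positivity)
    have e2 : (r : ℝ) ^ 3 * K ^ 2 ≤ r ^ 3 * K ^ 3 := by
      gcongr
      norm_num
    have e3 : ((Nbound r k : ℝ) + r * K * r * K + r * K) * r < Q.card * r := by
      have := mul_le_mul_of_nonneg_right h2 hrpos.le
      nlinarith
    have e4 := lt_of_mul_lt_mul_right e3 hrpos.le
    rw [hKdef] at e4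
    exact_mod_cast e4
  refine ⟨hmain, ?_⟩
  rintro ⟨Q, hQ⟩
  obtain ⟨U, W₁, W₂, x₁, x₂, y₁, y₂, -, h⟩ := hmain Q hQ
  exact ⟨_, h⟩
end
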